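/- Let d ≥ 2 and M, k ≥ 1 be integers, let f_M be chosen uniformly at random from L_M(d,k), let x > 0 be real with M ≥ 1/x, and let α = 9/10 if d = 2 and α = (3/4)^d if d ≥ 3. Then Pr( f_M(v_0)/M ≥ 1 + x ) ≤ (8M / (1 + 2^(1-d)·M)) · α^(d^⌊x - 1/M⌋). -/

import Mathlib

/-- The vertices of the rooted `d`-ary tree of depth `k`: sequences over `Fin d`
of length at most `k`.  The root is the empty sequence, the children of a vertex
`l` with `l.length < k` are the vertices `l ++ [j]` for `j : Fin d`, and the
leaves are the vertices of length exactly `k`. -/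
abbrev Vtx (d k : ℕ) : Type := {l : List (Fin d) // l.length ≤ k}

/-- The root `v₀` of the tree. -/
def rootV (d k : ℕ) : Vtx d k := ⟨[], by simp⟩

/-- `L_M(d,k)`: the set of integer-valued `M`-Lipschitz functions on the
`d`-ary tree of depth `k` that vanish on all leaves. -/
def LM (d k M : ℕ) : Set (Vtx d k → ℤ) :=
  {f | (∀ v : Vtx d k, v.1.length = k → f v = 0) ∧
       (∀ (l : List (Fin d)) (hl : l.length + 1 ≤ k) (j : Fin d),
         |f ⟨l ++ [j], by simpa using hl⟩ - f ⟨l, Nat.le_of_succ_le hl⟩| ≤ (M : ℤ))}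

/-- `G(t,k)`: the number of functions in `L_M(d,k)` whose value at the root is `t`. -/
noncomputable def G (d k M : ℕ) (t : ℤ) : ℕ :=
  Nat.card {f : Vtx d k → ℤ // f ∈ LM d k M ∧ f (rootV d k) = t}

/-- The probability that a uniformly random element of `L_M(d,k)` takes the
value `t` at the root. -/
noncomputable def PrRoot (d k M : ℕ) (t : ℤ) : ℝ :=
  (G d k M t : ℝ) / (Nat.card (LM d k M) : ℝ)

/-- The sum of `g` over the `n` consecutive integers starting at `a`. -/
noncomputable def intervalSum (g : ℤ → ℝ) (a : ℤ) (n : ℕ) : ℝ :=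
  ∑ i ∈ Finset.range n, g (a + i)

/-- The sum of `g` over the integers at distance at most `M` from `t`. -/
noncomputable def boxSum (M : ℕ) (g : ℤ → ℝ) (t : ℤ) : ℝ :=
  intervalSum g (t - M) (2 * M + 1)

/-- The number of functions in `L_M(d,k)` with root value `t`, computed by recursion on `k`. -/
noncomputable def rootWeight (d M : ℕ) : ℕ → ℤ → ℝ
  | 0 => fun t => if t = 0 then 1 else 0
  | k + 1 => fun t => boxSum M (rootWeight d M k) t ^ d

/-- Even log-concave weights on `ℤ`, positive at the origin. -/
structure IsLogConcaveEven (g : ℤ → ℝ) : Prop where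
  nonneg : ∀ t, 0 ≤ g t
  even : ∀ t, g (-t) = g t
  pos : 0 < g 0
  shift : ∀ a b c, a ≤ b → 0 ≤ c → g (b + c) * g a ≤ g (a + c) * g b

section IntervalSum

variable {g : ℤ → ℝ}

lemma intervalSum_add (g : ℤ → ℝ) (a : ℤ) (m n : ℕ) :
    intervalSum g a (m + n) = intervalSum g a m + intervalSum g (a + m) n := by
  simp only [intervalSum, Finset.sum_range_add, Nat.cast_add, add_assoc]

lemma intervalSum_eq_sum_Ico (g : ℤ → ℝ) (a : ℤ) (n : ℕ) :
    intervalSum g a n = ∑ z ∈ Finset.Ico a (a + n), g z := by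
  induction n with
  | zero => simp [intervalSum]
  | succ n ih =>
    have h : Finset.Ico a (a + (n + 1 : ℕ)) = insert (a + n) (Finset.Ico a (a + n)) := by
      ext z; simp only [Finset.mem_Ico, Finset.mem_insert]; omega
    rw [h, Finset.sum_insert (by simp), ← ih, intervalSum, Finset.sum_range_succ, add_comm]
    rfl

lemma boxSum_eq_sum_Icc (M : ℕ) (g : ℤ → ℝ) (t : ℤ) :
    boxSum M g t = ∑ z ∈ Finset.Icc (t - M) (t + M), g z := by
  rw [boxSum, intervalSum_eq_sum_Ico]
  congr 1
  ext z; simp only [Finset.mem_Ico, Finset.mem_Icc]; omega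

lemma intervalSum_nonneg (h : ∀ t, 0 ≤ g t) (a : ℤ) (n : ℕ) : 0 ≤ intervalSum g a n :=
  Finset.sum_nonneg fun _ _ => h _

lemma intervalSum_reflect (h : ∀ t, g (-t) = g t) {a b : ℤ} {n : ℕ} (hab : a + b + n = 1) :
    intervalSum g a n = intervalSum g b n := by
  unfold intervalSum
  rw [← Finset.sum_range_reflect]
  refine Finset.sum_congr rfl fun i hi => ?_
  rw [Finset.mem_range] at hi
  rw [← h]
  congr 1
  omega

lemma sum_mul_sum_le_of_sign {ι : Type*} [LinearOrder ι] (F : Finset ι) (p q u v : ι → ℝ)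
    (h₁ : ∀ z w, z ≤ w → p w * q z ≤ p z * q w) (h₂ : ∀ z w, z ≤ w → u z * v w ≤ u w * v z) :
    (∑ z ∈ F, p z * u z) * (∑ z ∈ F, q z * v z) ≤
      (∑ z ∈ F, p z * v z) * (∑ z ∈ F, q z * u z) := by
  have key : 0 ≤ ∑ z ∈ F, ∑ w ∈ F, (p z * q w - p w * q z) * (u w * v z - u z * v w) := by
    refine Finset.sum_nonneg fun z _ => Finset.sum_nonneg fun w _ => ?_
    rcases le_total z w with h | h
    · exact mul_nonneg (by linarith [h₁ z w h]) (by linarith [h₂ z w h])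
    · exact mul_nonneg_of_nonpos_of_nonpos (by linarith [h₁ w z h]) (by linarith [h₂ w z h])
  have expand : ∑ z ∈ F, ∑ w ∈ F, (p z * q w - p w * q z) * (u w * v z - u z * v w) =
      2 * ((∑ z ∈ F, p z * v z) * (∑ z ∈ F, q z * u z) -
        (∑ z ∈ F, p z * u z) * (∑ z ∈ F, q z * v z)) := by
    have e : ∀ z w, (p z * q w - p w * q z) * (u w * v z - u z * v w) =
        (p z * v z) * (q w * u w) - (p z * u z) * (q w * v w)
          + ((q z * u z) * (p w * v w) - (q z * v z) * (p w * u w)) := fun z w => by ring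
    simp only [e, Finset.sum_add_distrib, Finset.sum_sub_distrib, ← Finset.sum_mul_sum]
    ring
  linarith

lemma intervalSum_shift_le
    (hg : ∀ a b c, a ≤ b → 0 ≤ c → g (b + c) * g a ≤ g (a + c) * g b) (n : ℕ)
    {a b c : ℤ} (hab : a ≤ b) (hc : 0 ≤ c) :
    intervalSum g (b + c) n * intervalSum g a n ≤
      intervalSum g (a + c) n * intervalSum g b n := by
  have window : ∀ x e : ℤ, a ≤ x → x ≤ b →
      intervalSum g (x + e) n =
        ∑ z ∈ Finset.Ico a (b + n), (if x ≤ z ∧ z < x + n then (1 : ℝ) else 0) * g (z + e) := by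
    intro x e h₁ h₂
    have : intervalSum g (x + e) n = intervalSum (fun z => g (z + e)) x n :=
      Finset.sum_congr rfl fun i _ => by congr 1; ring
    rw [this, intervalSum_eq_sum_Ico]
    simp only [ite_mul, one_mul, zero_mul]
    rw [← Finset.sum_filter]
    congr 1
    ext z; simp only [Finset.mem_Ico, Finset.mem_filter]; omega
  have wa := window a 0 le_rfl hab
  have wb := window b 0 hab le_rfl
  simp only [add_zero] at wa wb
  rw [window b c hab le_rfl, window a c le_rfl hab, wa, wb, mul_comm]
  refine sum_mul_sum_le_of_sign _ _ _ _ _ (fun z w h => ?_) (fun z w h => ?_)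
  · split_ifs <;> first | (exfalso; omega) | norm_num
  · linarith [hg z w c h hc]

end IntervalSum

namespace IsLogConcaveEven

variable {g : ℤ → ℝ}

lemma antitone (hg : IsLogConcaveEven g) {u v : ℤ} (hu : 0 ≤ u) (huv : u ≤ v) : g v ≤ g u := by
  have h := hg.shift (-v) (-u) (u + v) (by omega) (by omega)
  rw [show -u + (u + v) = v by ring, show -v + (u + v) = u by ring, hg.even, hg.even] at h
  exact le_of_sq_le_sq (by nlinarith) (hg.nonneg u)

lemma intervalSum_antitone (hg : IsLogConcaveEven g) {a b : ℤ} (ha : 0 ≤ a) (hab : a ≤ b)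
    (n : ℕ) : intervalSum g b n ≤ intervalSum g a n :=
  Finset.sum_le_sum fun _ _ => hg.antitone (by omega) (by omega)

lemma intervalSum_mul_le (hg : IsLogConcaveEven g) {a b c : ℤ} (hab : a ≤ b) (hc : 0 ≤ c)
    (n : ℕ) : intervalSum g (b + c) n * g a ≤ g (a + c) * intervalSum g b n := by
  unfold intervalSum
  rw [Finset.sum_mul, Finset.mul_sum]
  refine Finset.sum_le_sum fun i _ => ?_
  have := hg.shift a (b + i) c (by omega) hc
  rwa [show b + i + c = b + c + i by ring] at this

lemma intervalSum_le_mul (hg : IsLogConcaveEven g) {a b c : ℤ} (hab : a ≤ b) (hc : 0 ≤ c)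
    (n : ℕ) {r : ℝ} (ha : 0 < g a) (hr : g (a + c) ≤ r * g a) :
    intervalSum g (b + c) n ≤ r * intervalSum g b n := by
  have h₁ := hg.intervalSum_mul_le hab hc n
  have h₂ := mul_le_mul_of_nonneg_right hr (intervalSum_nonneg hg.nonneg b n)
  refine le_of_mul_le_mul_right ?_ ha
  linarith

lemma intervalSum_le_card_mul (hg : IsLogConcaveEven g) {a : ℤ} (ha : 0 ≤ a) (n : ℕ) :
    intervalSum g a n ≤ n * g a := by
  have := Finset.sum_le_card_nsmul (Finset.range n) (fun i : ℕ => g (a + i)) (g a)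
    fun i _ => hg.antitone ha (by omega)
  simpa [intervalSum] using this

lemma card_mul_le_intervalSum (hg : IsLogConcaveEven g) {a b : ℤ} (ha : 0 ≤ a) {n : ℕ}
    (hb : a + n ≤ b + 1) : n * g b ≤ intervalSum g a n := by
  have := Finset.card_nsmul_le_sum (Finset.range n) (fun i : ℕ => g (a + i)) (g b)
    fun i hi => hg.antitone (by omega) (by rw [Finset.mem_range] at hi; omega)
  simpa [intervalSum] using this

lemma intervalSum_mono (hg : IsLogConcaveEven g) (a : ℤ) {m n : ℕ} (h : m ≤ n) :
    intervalSum g a m ≤ intervalSum g a n := by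
  obtain ⟨k, rfl⟩ := Nat.exists_eq_add_of_le h
  rw [intervalSum_add]
  linarith [intervalSum_nonneg hg.nonneg (a + m) k]

lemma boxSum_eq (hg : IsLogConcaveEven g) {M h : ℕ} (hh : h ≤ M) :
    boxSum M g h = intervalSum g 1 (M - h) + intervalSum g 0 (M + 1 + h) := by
  rw [boxSum, show 2 * M + 1 = (M - h) + (M + 1 + h) by omega, intervalSum_add,
    intervalSum_reflect (b := 1) hg.even (by omega)]
  congr 2
  omega

lemma boxSum_zero_eq (hg : IsLogConcaveEven g) (M : ℕ) :
    boxSum M g 0 = intervalSum g 1 M + intervalSum g 0 (M + 1) := by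
  simpa using hg.boxSum_eq (Nat.zero_le M)

lemma boxSum_succ_add_eq (g : ℤ → ℝ) {M h : ℕ} (hh : h ≤ M) :
    boxSum M g ((M + 1 : ℕ) + h) =
      intervalSum g (h + 1) (M - h) + intervalSum g (M + 1 : ℕ) (M + 1 + h) := by
  rw [boxSum, show 2 * M + 1 = (M - h) + (M + 1 + h) by omega, intervalSum_add]
  congr 2 <;> push_cast [Nat.cast_sub hh] <;> ring

lemma le_boxSum (hg : IsLogConcaveEven g) {M h : ℕ} (hh : h ≤ M) : g 0 ≤ boxSum M g h := by
  rw [hg.boxSum_eq hh]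
  have h₁ := hg.intervalSum_mono 0 (show 1 ≤ M + 1 + h by omega)
  have h₂ : intervalSum g 0 1 = g 0 := by simp [intervalSum]
  linarith [intervalSum_nonneg hg.nonneg 1 (M - h)]

lemma boxSum_zero_pos (hg : IsLogConcaveEven g) (M : ℕ) : 0 < boxSum M g 0 := by
  have := hg.le_boxSum (Nat.zero_le M)
  rw [Nat.cast_zero] at this
  linarith [hg.pos]

lemma boxSum_pow (hg : IsLogConcaveEven g) (M d : ℕ) :
    IsLogConcaveEven fun t => boxSum M g t ^ d where
  nonneg t := pow_nonneg (intervalSum_nonneg hg.nonneg _ _) _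
  even t := by
    simp only [boxSum]
    rw [intervalSum_reflect hg.even (b := t - M)]
    push_cast; ring
  pos := pow_pos (hg.boxSum_zero_pos M) d
  shift a b c hab hc := by
    simp only [← mul_pow]
    have := intervalSum_shift_le hg.shift (2 * M + 1) (a := a - M) (b := b - M) (c := c)
      (by omega) hc
    rw [show b - M + c = b + c - M by ring, show a - M + c = a + c - M by ring] at this
    exact pow_le_pow_left₀ (mul_nonneg (intervalSum_nonneg hg.nonneg _ _)
      (intervalSum_nonneg hg.nonneg _ _)) this d

/-- Shifting the box by `M + u` costs at least the factor `g u / g 0`. -/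
lemma boxSum_add_le (hg : IsLogConcaveEven g) (M u : ℕ) {r : ℝ} (hr0 : 0 ≤ r)
    (hr : g u ≤ r * g 0) : boxSum M g (M + u) ≤ r * boxSum M g 0 := by
  have h₁ := hg.intervalSum_le_mul (a := 0) (b := 0) (c := u) le_rfl (by omega) (2 * M + 1)
    hg.pos (by simpa using hr)
  have h₂ : intervalSum g 0 (2 * M + 1) ≤ boxSum M g 0 := by
    rw [show 2 * M + 1 = (M + 1) + M by ring, intervalSum_add, hg.boxSum_zero_eq]
    linarith [hg.intervalSum_antitone (a := 1) (b := 0 + (M + 1 : ℕ)) (by omega) (by omega) M]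
  rw [boxSum, show (M : ℤ) + u - M = 0 + u by ring]
  exact h₁.trans (mul_le_mul_of_nonneg_left h₂ hr0)

lemma boxSum_succ_le (hg : IsLogConcaveEven g) (M : ℕ) {r : ℝ} (hr : r ≤ 1)
    (h : intervalSum g (M + 1 : ℕ) (M + 1) ≤ r * intervalSum g 0 (M + 1)) :
    boxSum M g (M + 1 : ℕ) ≤ (1 + r) / 2 * boxSum M g 0 := by
  have e := boxSum_succ_add_eq g (Nat.zero_le M)
  simp only [Nat.cast_zero, add_zero, zero_add, Nat.sub_zero] at e
  rw [e, hg.boxSum_zero_eq]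
  have h₁ : intervalSum g 1 M ≤ intervalSum g 0 (M + 1) :=
    (hg.intervalSum_antitone le_rfl (by omega) M).trans (hg.intervalSum_mono 0 (by omega))
  nlinarith

lemma intervalSum_succ_le (hg : IsLogConcaveEven g) (M n : ℕ) {r : ℝ}
    (hr : g (M + 1 : ℕ) ≤ r * g 0) :
    intervalSum g (M + 1 : ℕ) n ≤ r * intervalSum g 0 n := by
  simpa using hg.intervalSum_le_mul (a := 0) (b := 0) (c := (M + 1 : ℕ)) le_rfl (by omega) n
    hg.pos (by simpa using hr)

end IsLogConcaveEven

lemma isLogConcaveEven_rootWeight (d M k : ℕ) : IsLogConcaveEven (rootWeight d M k) := by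
  induction k with
  | zero =>
    refine ⟨fun t => ?_, fun t => ?_, ?_, fun a b c hab hc => ?_⟩ <;> simp only [rootWeight]
    · split_ifs <;> norm_num
    · simp
    · simp
    · split_ifs <;> first | (exfalso; omega) | norm_num
  | succ k ih => exact ih.boxSum_pow M d

lemma rootWeight_succ_le_of_three_le {d : ℕ} (hd : 3 ≤ d) (M k : ℕ) :
    rootWeight d M k (M + 1 : ℕ) ≤ (3 / 4) ^ d * rootWeight d M k 0 := by
  induction k with
  | zero =>
    have : ((M + 1 : ℕ) : ℤ) ≠ 0 := by omega
    simp only [rootWeight, this, if_false, if_true]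
    positivity
  | succ k ih =>
    have hg := isLogConcaveEven_rootWeight d M k
    have hd' : ((3 : ℝ) / 4) ^ d ≤ 1 / 2 :=
      (pow_le_pow_of_le_one (by norm_num) (by norm_num) hd).trans (by norm_num)
    have h := hg.boxSum_succ_le M (by norm_num) (hg.intervalSum_succ_le M (M + 1)
      (ih.trans (mul_le_mul_of_nonneg_right hd' hg.pos.le)))
    simp only [rootWeight, ← mul_pow]
    refine pow_le_pow_left₀ (intervalSum_nonneg hg.nonneg _ _) (h.trans_eq ?_) d
    norm_num

lemma rootWeight_add_le (d M k n : ℕ) {α : ℝ} (hα : 0 ≤ α)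
    (h : ∀ k, rootWeight d M k (M + 1 : ℕ) ≤ α * rootWeight d M k 0) :
    rootWeight d M k (M * (n + 1) + 1 : ℕ) ≤ α ^ d ^ n * rootWeight d M k 0 := by
  induction n generalizing k with
  | zero => simpa using h k
  | succ n ih =>
    cases k with
    | zero =>
      have : ((M * (n + 1 + 1) + 1 : ℕ) : ℤ) ≠ 0 := by omega
      simp only [rootWeight, this, if_false, if_true]
      positivity
    | succ k =>
      have hg := isLogConcaveEven_rootWeight d M k
      have hb := hg.boxSum_add_le M _ (by positivity) (ih k)
      rw [pow_succ, pow_mul]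
      simp only [rootWeight, ← mul_pow]
      refine pow_le_pow_left₀ (intervalSum_nonneg hg.nonneg _ _) (le_of_eq_of_le ?_ hb) d
      congr 1
      push_cast; ring

/-- The two contraction estimates propagated by the recursion on the binary tree. -/
lemma rootWeight_two_contraction {M : ℕ} (hM : 1 ≤ M) (k : ℕ) :
    rootWeight 2 M k (M + 1 : ℕ) ≤ 9 / 10 * rootWeight 2 M k 0 ∧
      intervalSum (rootWeight 2 M k) (M + 1 : ℕ) (M + 1) ≤
        897 / 1000 * intervalSum (rootWeight 2 M k) 0 (M + 1) := by
  induction k with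
  | zero =>
    have h₀ : ((M + 1 : ℕ) : ℤ) ≠ 0 := by omega
    have h₁ := intervalSum_nonneg (isLogConcaveEven_rootWeight 2 M 0).nonneg 0 (M + 1)
    have h₂ : intervalSum (rootWeight 2 M 0) (M + 1 : ℕ) (M + 1) = 0 := by
      refine Finset.sum_eq_zero fun i _ => ?_
      simp only [rootWeight]
      rw [if_neg (by omega)]
    refine ⟨?_, by rw [h₂]; positivity⟩
    simp only [rootWeight, h₀, if_false, if_true]
    norm_num
  | succ k ih =>
    obtain ⟨ih₁, ih₂⟩ := ih
    have hg := isLogConcaveEven_rootWeight 2 M k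
    have hg' := isLogConcaveEven_rootWeight 2 M (k + 1)
    have hS0 := hg.boxSum_zero_pos M
    have hSN : 0 ≤ boxSum M (rootWeight 2 M k) (M + 1 : ℕ) := intervalSum_nonneg hg.nonneg _ _
    have first : rootWeight 2 M (k + 1) (M + 1 : ℕ) ≤ 9 / 10 * rootWeight 2 M (k + 1) 0 := by
      have h := pow_le_pow_left₀ hSN (hg.boxSum_succ_le M (by norm_num) ih₂) 2
      rw [mul_pow] at h
      refine h.trans (mul_le_mul_of_nonneg_right (by norm_num) (by positivity))
    refine ⟨first, ?_⟩
    rcases le_total (rootWeight 2 M (k + 1) (M + 1 : ℕ))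
      (897 / 1000 * rootWeight 2 M (k + 1) 0) with hsmall | hbig
    · exact hg'.intervalSum_succ_le M (M + 1) hsmall
    have hflat : 894 / 1000 * rootWeight 2 M k 0 ≤ rootWeight 2 M k (M + 1 : ℕ) := by
      by_contra! hlt
      have h := pow_le_pow_left₀ hSN (hg.boxSum_succ_le M (by norm_num)
        (hg.intervalSum_succ_le M (M + 1) hlt.le)) 2
      rw [mul_pow] at h
      simp only [rootWeight] at hbig
      have := pow_pos hS0 2
      linarith
    obtain ⟨h, hh⟩ : ∃ h : ℕ, h = (M + 1) / 2 := ⟨_, rfl⟩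
    have hhM : h ≤ M := by omega
    have hbox : boxSum M (rootWeight 2 M k) ((M + 1 : ℕ) + h) ≤
        94 / 100 * boxSum M (rootWeight 2 M k) h := by
      rw [IsLogConcaveEven.boxSum_succ_add_eq _ hhM, hg.boxSum_eq hhM]
      have h₁ := hg.intervalSum_succ_le M (M + 1 + h) ih₁
      have h₂ := hg.intervalSum_antitone (a := 1) (b := h + 1) (by omega) (by omega) (M - h)
      have h₃ := hg.intervalSum_le_card_mul (a := 1) (by omega) (M - h)
      have h₄ := hg.card_mul_le_intervalSum (a := 0) (b := (M + 1 : ℕ)) (n := M + 1) le_rfl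
        (by omega)
      have h₅ := hg.intervalSum_mono 0 (show M + 1 ≤ M + 1 + h by omega)
      have h₆ := hg.antitone (u := 0) (v := 1) le_rfl (by omega)
      have h₇ : ((M - h : ℕ) : ℝ) * 2 ≤ (M + 1 : ℕ) := by norm_cast; omega
      have h₈ : ((M - h : ℕ) : ℝ) * rootWeight 2 M k 1 ≤
          ((M + 1 : ℕ) : ℝ) / 2 * rootWeight 2 M k 0 :=
        mul_le_mul (by linarith) h₆ (hg.nonneg _) (by positivity)
      have h₉ := mul_le_mul_of_nonneg_left hflat (Nat.cast_nonneg (α := ℝ) (M + 1))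
      have hN : 0 ≤ ((M + 1 : ℕ) : ℝ) * rootWeight 2 M k 0 :=
        mul_nonneg (Nat.cast_nonneg _) hg.pos.le
      linarith
    have hmid : rootWeight 2 M (k + 1) (h + (M + 1 : ℕ)) ≤
        (94 / 100) ^ 2 * rootWeight 2 M (k + 1) h := by
      simp only [rootWeight, ← mul_pow]
      rw [add_comm (h : ℤ)]
      exact pow_le_pow_left₀ (intervalSum_nonneg hg.nonneg _ _) hbox 2
    have hpos : 0 < rootWeight 2 M (k + 1) h :=
      pow_pos (hg.pos.trans_le (hg.le_boxSum hhM)) 2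
    have tail : intervalSum (rootWeight 2 M (k + 1)) (h + (M + 1 : ℕ)) (M + 1 - h) ≤
        (94 / 100) ^ 2 * intervalSum (rootWeight 2 M (k + 1)) h (M + 1 - h) :=
      hg'.intervalSum_le_mul le_rfl (by omega) _ hpos hmid
    have head := hg'.intervalSum_succ_le M h first
    have hP := hg'.intervalSum_le_card_mul (a := 0) le_rfl h
    have hQ := hg'.card_mul_le_intervalSum (a := h) (b := (M + 1 : ℕ)) (n := M + 1 - h)
      (by omega) (by omega)
    have hcard : (h : ℝ) ≤ (M + 1 - h : ℕ) := by norm_cast; omega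
    have hPQ : (h : ℝ) * (897 / 1000 * rootWeight 2 M (k + 1) 0) ≤
        (M + 1 - h : ℕ) * rootWeight 2 M (k + 1) (M + 1 : ℕ) :=
      mul_le_mul hcard hbig (by linarith [hg'.pos]) (by positivity)
    have split : ∀ a : ℤ, intervalSum (rootWeight 2 M (k + 1)) a (M + 1) =
        intervalSum (rootWeight 2 M (k + 1)) a h +
          intervalSum (rootWeight 2 M (k + 1)) (h + a) (M + 1 - h) := fun a => by
      rw [add_comm (h : ℤ), ← intervalSum_add, Nat.add_sub_cancel' (by omega)]
    have hP₀ := intervalSum_nonneg hg'.nonneg 0 h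
    rw [split, split, add_zero]
    linarith

section Counting

lemma abs_le_of_mem_LM {d k M : ℕ} (hd : 0 < d) {f : Vtx d k → ℤ} (hf : f ∈ LM d k M)
    (m : ℕ) (v : Vtx d k) (hv : v.1.length + m = k) : |f v| ≤ M * m := by
  induction m generalizing v with
  | zero => simp [hf.1 v (by omega)]
  | succ m ih =>
    obtain ⟨l, hl⟩ := v
    have hl' : l.length + 1 ≤ k := by simp only at hv; omega
    have h₁ := hf.2 l hl' ⟨0, hd⟩
    have h₂ := ih ⟨l ++ [⟨0, hd⟩], by simpa using hl'⟩ (by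
      simp only [List.length_append, List.length_singleton] at hv ⊢
      omega)
    rw [abs_le] at h₁ h₂ ⊢
    push_cast
    constructor <;> linarith [h₁.1, h₁.2, h₂.1, h₂.2]

lemma finite_LM {d : ℕ} (hd : 0 < d) (k M : ℕ) : (LM d k M).Finite := by
  have : Finite (Vtx d k) := (List.finite_length_le (Fin d) k).to_subtype
  refine (Set.Finite.pi' (ι := Vtx d k)
    (t := fun _ => Set.Icc (-(M * k : ℤ)) (M * k)) fun _ => Set.finite_Icc _ _).subset ?_
  intro f hf v
  have h := abs_le_of_mem_LM hd hf (k - v.1.length) v (by have := v.2; omega)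
  have h' : (M : ℤ) * (k - v.1.length : ℕ) ≤ M * k := by gcongr; omega
  rw [Set.mem_Icc, ← abs_le]
  exact h.trans h'

lemma card_root_mem {d : ℕ} (hd : 0 < d) (k M : ℕ) (I : Finset ℤ) :
    Nat.card {f : Vtx d k → ℤ // f ∈ LM d k M ∧ f (rootV d k) ∈ I} = ∑ t ∈ I, G d k M t := by
  have hfin : ∀ t : ℤ, Finite {f : Vtx d k → ℤ // f ∈ LM d k M ∧ f (rootV d k) = t} :=
    fun t => ((finite_LM hd k M).subset fun f hf => hf.1 :
      {f : Vtx d k → ℤ | f ∈ LM d k M ∧ f (rootV d k) = t}.Finite).to_subtype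
  let e : {f : Vtx d k → ℤ // f ∈ LM d k M ∧ f (rootV d k) ∈ I} ≃
      Σ t : I, {f : Vtx d k → ℤ // f ∈ LM d k M ∧ f (rootV d k) = t} :=
    { toFun := fun f => ⟨⟨f.1 (rootV d k), f.2.2⟩, ⟨f.1, f.2.1, rfl⟩⟩
      invFun := fun p => ⟨p.2.1, p.2.2.1, by rw [p.2.2.2]; exact p.1.2⟩
      left_inv := fun f => rfl
      right_inv := by
        rintro ⟨⟨t, ht⟩, ⟨f, hf, hft⟩⟩
        obtain rfl : f (rootV d k) = t := hft
        rfl }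
  rw [Nat.card_congr e, Nat.card_sigma]
  exact Finset.sum_coe_sort I (G d k M)

/-- The restriction of a function on the tree to the subtree above the `i`-th child of the root. -/
def restrictChild {d k : ℕ} (f : Vtx d (k + 1) → ℤ) (i : Fin d) : Vtx d k → ℤ :=
  fun v => f ⟨i :: v.1, by simpa using v.2⟩

/-- The function with root value `t` and prescribed restrictions to the subtrees. -/
def joinChildren {d k : ℕ} (t : ℤ) (h : Fin d → Vtx d k → ℤ) : Vtx d (k + 1) → ℤ
  | ⟨[], _⟩ => t
  | ⟨i :: l, hl⟩ => h i ⟨l, by simpa using hl⟩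

/-- A function with root value `t` is the same as a family of functions on the subtrees, one for
each child of the root, whose root values are within `M` of `t`. -/
def childrenEquiv (d k M : ℕ) (t : ℤ) :
    {f : Vtx d (k + 1) → ℤ // f ∈ LM d (k + 1) M ∧ f (rootV d (k + 1)) = t} ≃
      (Fin d → {f : Vtx d k → ℤ //
        f ∈ LM d k M ∧ f (rootV d k) ∈ Finset.Icc (t - M) (t + M)}) where
  toFun f i := ⟨restrictChild f.1 i, by
    obtain ⟨f, ⟨hleaf, hlip⟩, hroot⟩ := f
    refine ⟨⟨fun v hv => hleaf _ (by simpa using hv), fun l hl j => ?_⟩, ?_⟩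
    · exact hlip (i :: l) (by simpa using hl) j
    · have h := hlip [] (by simp) i
      have hr : f ⟨[], by simp⟩ = t := hroot
      rw [hr, abs_le] at h
      have h' : restrictChild f i (rootV d k) = f ⟨[] ++ [i], by simp⟩ := rfl
      rw [Finset.mem_Icc, h']
      constructor <;> linarith [h.1, h.2]⟩
  invFun h := ⟨joinChildren t fun i => (h i).1, by
    refine ⟨⟨?_, ?_⟩, rfl⟩
    · rintro ⟨_ | ⟨i, l⟩, hl⟩ hv
      · simp at hv
      · exact (h i).2.1.1 _ (by simpa using hv)
    · rintro (_ | ⟨i, l⟩) hl j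
      · have h' := Finset.mem_Icc.1 (h j).2.2
        change |(h j).1 (rootV d k) - t| ≤ _
        rw [abs_le]
        constructor <;> linarith [h'.1, h'.2]
      · exact (h i).2.1.2 l (by simpa using hl) j⟩
  left_inv := by
    rintro ⟨f, hf, rfl⟩
    ext ⟨_ | ⟨i, l⟩, hl⟩ <;> rfl
  right_inv h := rfl

lemma G_zero (d M : ℕ) (t : ℤ) : G d 0 M t = if t = 0 then 1 else 0 := by
  have hLM : ∀ f : Vtx d 0 → ℤ, f ∈ LM d 0 M ↔ f = 0 := by
    refine fun f => ⟨fun hf => funext fun v => hf.1 v (Nat.le_zero.1 v.2), ?_⟩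
    rintro rfl
    exact ⟨fun _ _ => rfl, fun l hl => absurd hl (by omega)⟩
  unfold G
  split_ifs with ht
  · rw [Nat.card_eq_one_iff_unique]
    refine ⟨⟨fun f g => Subtype.ext ?_⟩, ⟨⟨0, (hLM 0).2 rfl, ht.symm⟩⟩⟩
    rw [(hLM _).1 f.2.1, (hLM _).1 g.2.1]
  · have : IsEmpty {f : Vtx d 0 → ℤ // f ∈ LM d 0 M ∧ f (rootV d 0) = t} :=
      ⟨fun f => ht (by rw [← f.2.2, (hLM _).1 f.2.1]; rfl)⟩
    exact Nat.card_of_isEmpty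

lemma G_succ {d : ℕ} (hd : 0 < d) (k M : ℕ) (t : ℤ) :
    G d (k + 1) M t = (∑ s ∈ Finset.Icc (t - M) (t + M), G d k M s) ^ d := by
  rw [G, Nat.card_congr (childrenEquiv d k M t), Nat.card_fun, Nat.card_fin, card_root_mem hd]

lemma G_eq_rootWeight {d : ℕ} (hd : 0 < d) (k M : ℕ) (t : ℤ) :
    (G d k M t : ℝ) = rootWeight d M k t := by
  induction k generalizing t with
  | zero => rw [G_zero]; simp [rootWeight]
  | succ k ih =>
    simp only [G_succ hd, rootWeight, boxSum_eq_sum_Icc, Nat.cast_pow, Nat.cast_sum, ih]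

lemma card_root_mem_Ico {d : ℕ} (hd : 0 < d) (k M : ℕ) (a : ℤ) (n : ℕ) :
    (Nat.card {f : Vtx d k → ℤ // f ∈ LM d k M ∧ f (rootV d k) ∈ Finset.Ico a (a + n)} : ℝ) =
      intervalSum (rootWeight d M k) a n := by
  rw [card_root_mem hd, intervalSum_eq_sum_Ico]
  push_cast
  exact Finset.sum_congr rfl fun t _ => G_eq_rootWeight hd k M t

/-- The tail of the root value is controlled by the ratio of its weight at `T` and at `0`. -/
lemma card_root_ge_le {d : ℕ} (hd : 0 < d) (k M T : ℕ) {r : ℝ} (hr₀ : 0 ≤ r)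
    (hr : rootWeight d M k T ≤ r * rootWeight d M k 0) :
    (Nat.card {f : Vtx d k → ℤ // f ∈ LM d k M ∧ (T : ℤ) ≤ f (rootV d k)} : ℝ) ≤
      r * Nat.card (LM d k M) := by
  have hfin := finite_LM hd k M
  have hg := isLogConcaveEven_rootWeight d M k
  have h₁ : Nat.card {f : Vtx d k → ℤ // f ∈ LM d k M ∧ (T : ℤ) ≤ f (rootV d k)} ≤
      Nat.card {f : Vtx d k → ℤ // f ∈ LM d k M ∧
        f (rootV d k) ∈ Finset.Ico (T : ℤ) (T + (M * k + 1 : ℕ))} := by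
    refine Nat.card_mono (hfin.subset fun f hf => hf.1) fun f hf => ⟨hf.1, ?_⟩
    have := (abs_le.1 (abs_le_of_mem_LM hd hf.1 k (rootV d k) (by simp [rootV]))).2
    rw [Finset.mem_Ico]
    push_cast
    exact ⟨hf.2, by omega⟩
  have h₂ : Nat.card {f : Vtx d k → ℤ // f ∈ LM d k M ∧
      f (rootV d k) ∈ Finset.Ico (0 : ℤ) (0 + (M * k + 1 : ℕ))} ≤ Nat.card (LM d k M) :=
    Nat.card_mono hfin fun f hf => hf.1
  have h₃ := hg.intervalSum_le_mul (a := 0) (b := 0) (c := T) le_rfl (by omega) (M * k + 1)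
    hg.pos (by simpa using hr)
  rw [← Nat.cast_le (α := ℝ), card_root_mem_Ico hd] at h₁ h₂
  rw [zero_add] at h₃
  exact (h₁.trans h₃).trans (mul_le_mul_of_nonneg_left h₂ hr₀)

end Counting

/-- **Tail bound for the rescaled root value.**  Let `f_M` be uniform on
`L_M(d,k)`, let `x > 0` with `M ≥ 1/x`, and let `α = 9/10` if `d = 2` and
`α = (3/4)^d` if `d ≥ 3`.  Then
`Pr(f_M(v₀)/M ≥ 1 + x) ≤ (8M / (1 + 2^(1-d) M)) * α^(d^⌊x - 1/M⌋)`. -/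
theorem lipschitz_tree_rescaled_tail (d M k : ℕ) (hd : 2 ≤ d) (hM : 1 ≤ M)
    (hk : 1 ≤ k) (x : ℝ) (hx : 0 < x) (hMx : 1 / x ≤ (M : ℝ)) (α : ℝ)
    (hα : α = if d = 2 then (9 / 10 : ℝ) else (3 / 4 : ℝ) ^ d) :
    (Nat.card {f : Vtx d k → ℤ //
        f ∈ LM d k M ∧ 1 + x ≤ (f (rootV d k) : ℝ) / (M : ℝ)} : ℝ) /
      (Nat.card (LM d k M) : ℝ) ≤
    8 * (M : ℝ) / (1 + (2 : ℝ) ^ ((1 : ℤ) - (d : ℤ)) * (M : ℝ)) *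
      α ^ (d ^ (⌊x - 1 / (M : ℝ)⌋.toNat)) := by
  have hd₀ : 0 < d := by omega
  have hM₀ : (0 : ℝ) < M := by exact_mod_cast hM
  have hα₀ : 0 ≤ α := by rw [hα]; split_ifs <;> positivity
  obtain ⟨n, hn⟩ : ∃ n, n = ⌊x - 1 / (M : ℝ)⌋.toNat := ⟨_, rfl⟩
  have hx' : 0 ≤ x - 1 / (M : ℝ) := by
    rw [sub_nonneg, div_le_iff₀ hM₀, mul_comm]
    exact (div_le_iff₀ hx).1 hMx
  have hnx : (n : ℝ) ≤ x - 1 / (M : ℝ) := by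
    have h : (n : ℤ) = ⌊x - 1 / (M : ℝ)⌋ := by
      rw [hn]; exact Int.toNat_of_nonneg (Int.floor_nonneg.2 hx')
    have := Int.floor_le (x - 1 / (M : ℝ))
    rw [← h] at this
    exact_mod_cast this
  rw [← hn]
  have hstep : ∀ k, rootWeight d M k (M + 1 : ℕ) ≤ α * rootWeight d M k 0 := by
    intro k
    rw [hα]
    split_ifs with h
    · subst h
      exact (rootWeight_two_contraction hM k).1
    · exact rootWeight_succ_le_of_three_le (by omega) M k
  have hr : 0 ≤ α ^ d ^ n := pow_nonneg hα₀ _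
  have htail := card_root_ge_le hd₀ k M _ hr (rootWeight_add_le d M k n hα₀ hstep)
  have hsub : Nat.card {f : Vtx d k → ℤ //
        f ∈ LM d k M ∧ 1 + x ≤ (f (rootV d k) : ℝ) / (M : ℝ)} ≤
      Nat.card {f : Vtx d k → ℤ //
        f ∈ LM d k M ∧ ((M * (n + 1) + 1 : ℕ) : ℤ) ≤ f (rootV d k)} := by
    refine Nat.card_mono ((finite_LM hd₀ k M).subset fun f hf => hf.1) fun f hf => ⟨hf.1, ?_⟩
    have h₁ := (le_div_iff₀ hM₀).1 hf.2
    have h₂ := mul_le_mul_of_nonneg_right hnx hM₀.le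
    rw [sub_mul, one_div, inv_mul_cancel₀ hM₀.ne'] at h₂
    rw [← Int.cast_le (R := ℝ)]
    push_cast
    linarith
  have hprob : (Nat.card {f : Vtx d k → ℤ //
        f ∈ LM d k M ∧ 1 + x ≤ (f (rootV d k) : ℝ) / (M : ℝ)} : ℝ) /
      (Nat.card (LM d k M) : ℝ) ≤ α ^ d ^ n :=
    div_le_of_le_mul₀ (Nat.cast_nonneg _) hr ((Nat.cast_le.2 hsub).trans htail)
  refine hprob.trans (le_mul_of_one_le_left hr ?_)
  have hpow : (2 : ℝ) ^ ((1 : ℤ) - (d : ℤ)) ≤ 1 :=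
    zpow_le_one_of_nonpos₀ (by norm_num) (by omega)
  have hM₁ : (1 : ℝ) ≤ M := by exact_mod_cast hM
  rw [one_le_div (by positivity)]
  nlinarith
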